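/- arXiv:2106.13983 — 2 statements merged into one kernel-verified Lean document; each statement's English description precedes it below -/
import Mathlib

section
/- Let K be a number field with ring of integers O_K, and let 𝔫 be a nonzero ideal of O_K. Define φ₂(𝔫) as the number of pairs (a,b) of units of O_K/𝔫 such that a+b is also a unit of O_K/𝔫. Then φ₂(𝔫) = φ(𝔫)² · ∏_{𝔭 | 𝔫} (1 − 1/(N(𝔭)−1)), where the product runs over prime ideals dividing 𝔫, φ(𝔫) = |(O_K/𝔫)^×|, and N(𝔭) = |O_K/𝔭|. -/
open NumberField

set_option synthInstance.maxHeartbeats 1000000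
set_option maxHeartbeats 1000000

/-- All fibres of a surjective homomorphism of finite groups have the same cardinality. -/
theorem MonoidHom.card_mul_card_preimage {G H : Type*} [Group G] [Group H] [Finite G] [Finite H]
    (f : G →* H) (hf : Function.Surjective f) (S : Set H) :
    Nat.card H * Nat.card (f ⁻¹' S) = Nat.card G * Nat.card S := by
  have key (T : Set H) : Nat.card (f ⁻¹' T) = Nat.card T * Nat.card f.ker := by
    rw [← Nat.card_prod]
    choose g hg using hf
    refine Nat.card_congr
      { toFun := fun x => (⟨f x, x.2⟩, ⟨(g (f x))⁻¹ * x, by simp [MonoidHom.mem_ker, hg]⟩)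
        invFun := fun y => ⟨g y.1 * y.2, by
          simp [hg, MonoidHom.mem_ker.mp y.2.2]⟩
        left_inv := fun x => by simp
        right_inv := fun y => by
          ext <;> simp [hg, MonoidHom.mem_ker.mp y.2.2] }
  have hG := key Set.univ
  rw [Set.preimage_univ, Nat.card_univ, Nat.card_univ] at hG
  rw [key, hG]
  ring

/-- The pairs of units whose sum is a unit. -/
def unitPairs (R : Type*) [Ring R] : Set (Rˣ × Rˣ) :=
  {p | IsUnit ((p.1 : R) + (p.2 : R))}

theorem card_unitPairs_add_card_units (F : Type*) [Field F] [Finite F] :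
    Nat.card (unitPairs F) + Nat.card Fˣ = Nat.card Fˣ ^ 2 := by
  have h : Nat.card ↥(unitPairs F)ᶜ = Nat.card Fˣ := by
    refine Nat.card_congr
      { toFun := fun p => p.1.1
        invFun := fun a => ⟨(a, -a), by simp [unitPairs]⟩
        left_inv := ?_
        right_inv := fun a => rfl }
    rintro ⟨⟨a, b⟩, hab⟩
    have : (a : F) + b = 0 := by simpa [unitPairs] using hab
    have hb : b = -a := by
      ext
      simpa using eq_neg_of_add_eq_zero_right this
    simp [hb]
  rw [← h, Nat.card_coe_set_eq, Nat.card_coe_set_eq, Set.ncard_add_ncard_compl,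
    ← Nat.card_coe_set_eq, h, Nat.card_prod, sq]

theorem card_unitPairs_field (F : Type*) [Field F] [Finite F] :
    (Nat.card (unitPairs F) : ℚ) = (Nat.card Fˣ : ℚ) ^ 2 * (1 - 1 / ((Nat.card F : ℚ) - 1)) := by
  have h : (Nat.card (unitPairs F) : ℚ) + Nat.card Fˣ = (Nat.card Fˣ : ℚ) ^ 2 := by
    exact_mod_cast card_unitPairs_add_card_units F
  have hu : (Nat.card F : ℚ) - 1 = Nat.card Fˣ := by
    rw [Nat.card_units, Nat.cast_sub Nat.card_pos, Nat.cast_one]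
  have h0 : (Nat.card Fˣ : ℚ) ≠ 0 := by exact_mod_cast Nat.card_pos.ne'
  rw [hu, eq_sub_of_add_eq h]
  field_simp

theorem card_unitPairs_of_finite (R : Type*) [CommRing R] [Finite R] [Fintype (MaximalSpectrum R)] :
    (Nat.card (unitPairs R) : ℚ) = (Nat.card Rˣ : ℚ) ^ 2 *
      ∏ I : MaximalSpectrum R, (1 - 1 / ((Nat.card (R ⧸ I.asIdeal) : ℚ) - 1)) := by
  have finite_quotient (I : MaximalSpectrum R) : Finite (R ⧸ I.asIdeal) :=
    Finite.of_surjective _ Ideal.Quotient.mk_surjective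
  let π (I : MaximalSpectrum R) : Rˣ →* (R ⧸ I.asIdeal)ˣ := Units.map (Ideal.Quotient.mk I.asIdeal)
  let f : Rˣ × Rˣ →* ∀ I : MaximalSpectrum R, (R ⧸ I.asIdeal)ˣ × (R ⧸ I.asIdeal)ˣ :=
    MonoidHom.pi fun I => (π I).prodMap (π I)
  have isUnit_iff (a : R) :
      IsUnit a ↔ ∀ I : MaximalSpectrum R, IsUnit (Ideal.Quotient.mk I.asIdeal a) := by
    refine ⟨fun h I => h.map _, fun h => ?_⟩
    by_contra ha
    obtain ⟨M, hM, haM⟩ := exists_max_ideal_of_mem_nonunits ha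
    have := h ⟨M, hM⟩
    rw [Ideal.Quotient.eq_zero_iff_mem.mpr haM] at this
    have := Ideal.Quotient.nontrivial_iff.mpr hM.ne_top
    exact not_isUnit_zero ‹_›
  have lift (u : ∀ I : MaximalSpectrum R, (R ⧸ I.asIdeal)ˣ) : ∃ a : Rˣ, ∀ I, π I a = u I := by
    obtain ⟨a, ha⟩ := Ideal.pi_quotient_surjective
      (I := fun I : MaximalSpectrum R => I.asIdeal)
      (fun I J h => Ideal.isCoprime_of_isMaximal fun e => h (MaximalSpectrum.ext e))
      (fun I => (u I : R ⧸ I.asIdeal))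
    have hu : IsUnit a := (isUnit_iff a).mpr fun I => by rw [ha]; exact (u I).isUnit
    exact ⟨hu.unit, fun I => Units.ext (ha I)⟩
  have hf : Function.Surjective f := fun u => by
    obtain ⟨a, ha⟩ := lift fun I => (u I).1
    obtain ⟨b, hb⟩ := lift fun I => (u I).2
    exact ⟨(a, b), funext fun I => Prod.ext (ha I) (hb I)⟩
  have hpre : f ⁻¹' Set.univ.pi (fun I : MaximalSpectrum R => unitPairs (R ⧸ I.asIdeal)) =
      unitPairs R := by
    ext p
    simp only [Set.mem_preimage, Set.mem_univ_pi, unitPairs, Set.mem_ofPred_eq, isUnit_iff, map_add]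
    rfl
  have h := f.card_mul_card_preimage hf
    (Set.univ.pi fun I : MaximalSpectrum R => unitPairs (R ⧸ I.asIdeal))
  rw [hpre, Nat.card_congr (Equiv.Set.univPi _), Nat.card_pi, Nat.card_pi, Nat.card_prod] at h
  simp only [Nat.card_prod] at h
  have hq : (∏ I : MaximalSpectrum R, (Nat.card (R ⧸ I.asIdeal)ˣ : ℚ) ^ 2) ≠ 0 :=
    Finset.prod_ne_zero_iff.mpr fun I _ => pow_ne_zero 2 (by exact_mod_cast Nat.card_pos.ne')
  have hprod (I : MaximalSpectrum R) : (Nat.card (unitPairs (R ⧸ I.asIdeal)) : ℚ) =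
      (Nat.card (R ⧸ I.asIdeal)ˣ : ℚ) ^ 2 * (1 - 1 / ((Nat.card (R ⧸ I.asIdeal) : ℚ) - 1)) :=
    letI := Ideal.Quotient.field I.asIdeal
    card_unitPairs_field (R ⧸ I.asIdeal)
  apply mul_left_cancel₀ hq
  have h' := congrArg (Nat.cast : ℕ → ℚ) h
  push_cast at h'
  simp only [hprod, Finset.prod_mul_distrib, ← sq] at h'
  rw [h']
  ring

/-- Carlitz-type formula in the ring of algebraic integers: for a nonzero ideal `𝔫`
of `𝓞 K`, the number `φ₂(𝔫)` of pairs `(a,b)` of units of `𝓞 K ⧸ 𝔫` with `a + b`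
a unit equals `φ(𝔫)² · ∏_{𝔭 ∣ 𝔫} (1 − 1/(N(𝔭)−1))`. -/
theorem phi_two_formula_ideal (K : Type*) [Field K] [NumberField K]
    (𝔫 : Ideal (𝓞 K)) (h𝔫 : 𝔫 ≠ ⊥) :
    (Nat.card {p : ((𝓞 K ⧸ 𝔫)ˣ) × ((𝓞 K ⧸ 𝔫)ˣ) //
        IsUnit ((p.1 : 𝓞 K ⧸ 𝔫) + (p.2 : 𝓞 K ⧸ 𝔫))} : ℚ) =
      (Nat.card ((𝓞 K ⧸ 𝔫)ˣ) : ℚ) ^ 2 *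
        ∏ᶠ (𝔭 : Ideal (𝓞 K)) (_ : 𝔭.IsPrime ∧ 𝔭 ∣ 𝔫),
          (1 - 1 / ((Ideal.absNorm 𝔭 : ℚ) - 1)) := by
  have : Finite (𝓞 K ⧸ 𝔫) := Ideal.finiteQuotientOfFreeOfNeBot 𝔫 h𝔫
  have := Fintype.ofFinite (MaximalSpectrum (𝓞 K ⧸ 𝔫))
  let g (I : MaximalSpectrum (𝓞 K ⧸ 𝔫)) : Ideal (𝓞 K) := I.asIdeal.comap (Ideal.Quotient.mk 𝔫)
  have hg : Function.Injective g := fun I J h => MaximalSpectrum.ext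
    (Ideal.comap_injective_of_surjective _ Ideal.Quotient.mk_surjective h)
  have hrange : Set.range g = {𝔭 | 𝔭.IsPrime ∧ 𝔭 ∣ 𝔫} := by
    ext 𝔭
    refine ⟨?_, fun ⟨hp, hdvd⟩ => ?_⟩
    · rintro ⟨I, rfl⟩
      have := I.isMaximal.isPrime
      refine ⟨Ideal.comap_isPrime _ _, Ideal.dvd_iff_le.mpr fun x hx => ?_⟩
      simp [g, Ideal.mem_comap, Ideal.Quotient.eq_zero_iff_mem.mpr hx]
    · have hle := Ideal.dvd_iff_le.mp hdvd
      have hker : RingHom.ker (Ideal.Quotient.mk 𝔫) ≤ 𝔭 := by rwa [Ideal.mk_ker]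
      have hmax : 𝔭.IsMaximal := hp.isMaximal (ne_bot_of_le_ne_bot h𝔫 hle)
      have hcomap : (𝔭.map (Ideal.Quotient.mk 𝔫)).comap (Ideal.Quotient.mk 𝔫) = 𝔭 :=
        Ideal.comap_map_of_surjective' _ Ideal.Quotient.mk_surjective 𝔭 |>.trans
          (sup_eq_left.mpr hker)
      exact ⟨⟨_, Ideal.IsMaximal.map_of_surjective_of_ker_le
        Ideal.Quotient.mk_surjective hker⟩, hcomap⟩
  have hnorm (I : MaximalSpectrum (𝓞 K ⧸ 𝔫)) :
      Ideal.absNorm (g I) = Nat.card ((𝓞 K ⧸ 𝔫) ⧸ I.asIdeal) := by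
    rw [Ideal.absNorm_apply]
    have hk : RingHom.ker ((Ideal.Quotient.mk I.asIdeal).comp (Ideal.Quotient.mk 𝔫)) = g I := by
      rw [← RingHom.comap_ker, Ideal.mk_ker]
    exact Nat.card_congr ((Ideal.quotEquivOfEq hk.symm).trans
      (RingHom.quotientKerEquivOfSurjective
        (Ideal.Quotient.mk_surjective.comp Ideal.Quotient.mk_surjective))).toEquiv
  have hprod : ∏ᶠ (𝔭 : Ideal (𝓞 K)) (_ : 𝔭.IsPrime ∧ 𝔭 ∣ 𝔫),
        (1 - 1 / ((Ideal.absNorm 𝔭 : ℚ) - 1)) =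
      ∏ I : MaximalSpectrum (𝓞 K ⧸ 𝔫),
        (1 - 1 / ((Nat.card ((𝓞 K ⧸ 𝔫) ⧸ I.asIdeal) : ℚ) - 1)) := by
    change ∏ᶠ 𝔭 ∈ {𝔭 : Ideal (𝓞 K) | 𝔭.IsPrime ∧ 𝔭 ∣ 𝔫}, _ = _
    rw [← hrange, finprod_mem_range hg, finprod_eq_prod_of_fintype]
    simp only [hnorm]
  rw [hprod]
  exact card_unitPairs_of_finite (𝓞 K ⧸ 𝔫)
end

section
/- For positive integers k and n, a Dirichlet character χ modulo n with conductor d induced by the primitive character ψ modulo d, and an integer r coprime to n: writing n₀ for the largest divisor of n with the same prime factors as d satisfying gcd(n₀, n/n₀) = 1, we have ∑ gcd(a₁+⋯+a_k−r, b₁, …, b_s, n) · χ(a₁) = μ(d)^{k−1} · ψ(r) · φ(n₀^k/d^{k−1}) · φ_k(n/n₀) · σ_s(n/d), where the sum runs over 1 ≤ a₁,…,a_k ≤ n with gcd(a₁⋯a_k, n) = 1 and gcd(a₁+⋯+a_k, n) = 1, and 1 ≤ b₁,…,b_s ≤ n. -/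
/-- The `k`-dimensional generalized Euler function `φ_k(n)`. -/
def tothPhi (k n : ℕ) : ℕ :=
  ((Fintype.piFinset fun _ : Fin k => Finset.Icc 1 n).filter
    (fun a => Nat.gcd (∏ i, a i) n = 1 ∧ Nat.gcd (∑ i, a i) n = 1)).card

namespace DirichletCharacter

open Finset

variable {n : ℕ} [NeZero n]

lemma sum_fiber_cast_eq_zero (χ : DirichletCharacter ℂ n) {e : ℕ} (he : e ∣ n)
    (hd : ¬ χ.conductor ∣ e) (z : ZMod e) :
    ∑ y : ZMod n with (y.cast : ZMod e) = z, χ y = 0 := by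
  rw [← χ.mem_conductorSet_iff_conductor_dvd he, mem_conductorSet_iff,
    factorsThrough_iff_ker_unitsMap he, SetLike.not_le_iff_exists] at hd
  obtain ⟨u, hu, hχ⟩ := hd
  have hu' : ((u : ZMod n).cast : ZMod e) = 1 := by
    rw [← ZMod.unitsMap_val he, MonoidHom.mem_ker.1 hu, Units.val_one]
  have hχ' : χ u ≠ 1 := by
    intro h
    exact hχ (MonoidHom.mem_ker.2 (Units.ext (by simpa using h)))
  have key : χ u * ∑ y : ZMod n with (y.cast : ZMod e) = z, χ y =
      ∑ y : ZMod n with (y.cast : ZMod e) = z, χ y := by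
    rw [mul_sum, sum_filter, sum_filter]
    refine Fintype.sum_equiv (Units.mulLeft u) _ _ fun y ↦ ?_
    simp [ZMod.cast_mul he, hu']
  have : (χ u - 1) * ∑ y : ZMod n with (y.cast : ZMod e) = z, χ y = 0 := by
    rw [sub_mul, key, one_mul, sub_self]
  exact (mul_eq_zero.1 this).resolve_left (sub_ne_zero.2 hχ')

lemma totient_mul_sum_fiber_one {e : ℕ} (he : e ∣ n) (z : (ZMod e)ˣ) :
    (e.totient : ℂ) * ∑ y : ZMod n with (y.cast : ZMod e) = z, (1 : DirichletCharacter ℂ n) y =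
      n.totient := by
  have : NeZero e := ⟨fun h ↦ NeZero.ne n (Nat.eq_zero_of_zero_dvd (h ▸ he))⟩
  set f : ZMod e → ℂ := fun w ↦
    ∑ y : ZMod n with (y.cast : ZMod e) = w, (1 : DirichletCharacter ℂ n) y with hf
  have hscale (u : (ZMod e)ˣ) : f u = f 1 := by
    obtain ⟨v, rfl⟩ := ZMod.unitsMap_surjective he u
    simp only [hf, sum_filter]
    refine (Fintype.sum_equiv (Units.mulLeft v) _ _ fun y ↦ ?_).symm
    rw [Units.mulLeft_apply, map_mul, MulChar.one_apply v.isUnit, one_mul, ZMod.cast_mul he,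
      ZMod.unitsMap_val]
    have hv : IsUnit ((v : ZMod n).cast : ZMod e) := ZMod.isUnit_cast_of_dvd he v
    simp only [hv.mul_eq_left]
  have hnon (w : ZMod e) (hw : ¬ IsUnit w) : f w = 0 := by
    refine sum_eq_zero fun y hy ↦ MulChar.map_nonunit _ fun h ↦ hw ?_
    rw [← (mem_filter.1 hy).2]
    exact ZMod.isUnit_cast_of_dvd he h.unit
  have hf1 (w : ZMod e) : f w = (1 : DirichletCharacter ℂ e) w * f 1 := by
    by_cases hw : IsUnit w
    · rw [MulChar.one_apply hw, one_mul]
      exact hscale hw.unit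
    · rw [hnon w hw, MulChar.map_nonunit _ hw, zero_mul]
  have hsum : ∑ w, f w = n.totient := by
    simp only [hf]
    rw [sum_fiberwise, MulChar.sum_one_eq_card_units, ZMod.card_units_eq_totient]
  rw [sum_congr rfl fun w _ ↦ hf1 w, ← sum_mul, MulChar.sum_one_eq_card_units,
    ZMod.card_units_eq_totient] at hsum
  rw [← hsum]
  congr 1
  exact hscale z

lemma apply_eq_primitiveCharacter_cast {m : ℕ} (χ : DirichletCharacter ℂ m) {y : ZMod m}
    (hy : IsUnit y) : χ y = χ.primitiveCharacter y.cast := by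
  conv_lhs => rw [← χ.changeLevel_primitiveCharacter]
  exact changeLevel_eq_cast_of_dvd _ χ.conductor_dvd_level hy.unit

lemma totient_mul_sum_fiber (χ : DirichletCharacter ℂ n) {e : ℕ} (he : e ∣ n)
    (hd : χ.conductor ∣ e) {r : ℤ} (hr : IsCoprime r n) :
    (e.totient : ℂ) * ∑ y : ZMod n with (y.cast : ZMod e) = r, χ y =
      n.totient * χ.primitiveCharacter r := by
  have hre : IsUnit (r : ZMod e) := by
    rw [ZMod.coe_int_isUnit_iff_isCoprime]
    exact (hr.of_isCoprime_of_dvd_right (Int.natCast_dvd_natCast.2 he)).symm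
  rw [← totient_mul_sum_fiber_one he hre.unit, mul_assoc, sum_mul]
  congr 1
  refine sum_congr rfl fun y hy ↦ ?_
  by_cases hu : IsUnit y
  · rw [MulChar.one_apply hu, one_mul, apply_eq_primitiveCharacter_cast χ hu,
      ← ZMod.cast_intCast hd r, show (r : ZMod e) = y.cast from (mem_filter.1 hy).2.symm]
    congr 1
    have := DFunLike.congr_fun (ZMod.castHom_comp hd he) y
    exact this.symm
  · rw [MulChar.map_nonunit _ hu, MulChar.map_nonunit _ hu, zero_mul]

lemma card_fiber_cast {e : ℕ} (he : e ∣ n) (z : ZMod e) :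
    #{y : ZMod n | (y.cast : ZMod e) = z} = n / e := by
  have : NeZero e := ⟨fun h ↦ NeZero.ne n (Nat.eq_zero_of_zero_dvd (h ▸ he))⟩
  have hs := ZMod.castHom_surjective he
  have hc (w : ZMod e) :
      #{y : ZMod n | (y.cast : ZMod e) = w} = #{y : ZMod n | (y.cast : ZMod e) = z} :=
    AddMonoidHom.card_fiber_eq_of_mem_range (ZMod.castHom he (ZMod e)) (hs w) (hs z)
  have h := card_eq_sum_card_fiberwise (s := (univ : Finset (ZMod n)))
    (f := fun y ↦ (y.cast : ZMod e)) (t := univ) (fun _ _ ↦ mem_coe.2 (mem_univ _))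
  rw [sum_congr rfl fun w _ ↦ hc w, sum_const, card_univ, card_univ, ZMod.card, ZMod.card,
    smul_eq_mul] at h
  exact (Nat.div_eq_of_eq_mul_right (Nat.pos_of_neZero e) h).symm

lemma one_apply_eq_sum_moebius (t : ZMod n) :
    (1 : DirichletCharacter ℂ n) t =
      ∑ e ∈ n.divisors, if (t.cast : ZMod e) = 0 then (ArithmeticFunction.moebius e : ℂ) else 0 := by
  have hdiv : n.divisors.filter (fun e ↦ (t.cast : ZMod e) = 0) = (t.val.gcd n).divisors := by
    ext e
    rw [mem_filter, Nat.mem_divisors, Nat.mem_divisors, Nat.dvd_gcd_iff, ← ZMod.natCast_val,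
      ZMod.natCast_eq_zero_iff]
    have := NeZero.ne n
    have := Nat.gcd_ne_zero_right (m := t.val) (NeZero.ne n)
    tauto
  have hu : IsUnit t ↔ t.val.gcd n = 1 := by
    rw [← Nat.coprime_iff_gcd_eq_one, ← ZMod.isUnit_iff_coprime, ZMod.natCast_zmod_val]
  rw [← sum_filter, hdiv, ← Int.cast_sum, ← ArithmeticFunction.coe_mul_zeta_apply,
    ArithmeticFunction.moebius_mul_coe_zeta, ArithmeticFunction.one_apply]
  by_cases h : IsUnit t
  · rw [MulChar.one_apply h, if_pos (hu.1 h), Int.cast_one]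
  · rw [MulChar.map_nonunit _ h, if_neg (hu.not.1 h), Int.cast_zero]

lemma sum_one_mul_apply_sub (χ : DirichletCharacter ℂ n)
    (hp : n.primeFactors = χ.conductor.primeFactors) (x : ZMod n) :
    ∑ t, (1 : DirichletCharacter ℂ n) t * χ (x - t) =
      ArithmeticFunction.moebius χ.conductor * (n / χ.conductor : ℕ) * χ x := by
  have hin (e : ℕ) (he : e ∈ n.divisors) :
      (∑ t : ZMod n, (if (t.cast : ZMod e) = 0 then (ArithmeticFunction.moebius e : ℂ) else 0) *
        χ (x - t)) =
      ArithmeticFunction.moebius e * ∑ y : ZMod n with (y.cast : ZMod e) = x.cast, χ y := by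
    rw [sum_filter, mul_sum]
    refine Fintype.sum_equiv (Equiv.subLeft x) _ _ fun t ↦ ?_
    simp [ZMod.cast_sub (Nat.dvd_of_mem_divisors he)]
  simp_rw [one_apply_eq_sum_moebius, sum_mul]
  rw [sum_comm, sum_congr rfl hin, sum_eq_single χ.conductor]
  · rw [mul_assoc, ← card_fiber_cast χ.conductor_dvd_level (x.cast : ZMod χ.conductor),
      ← nsmul_eq_mul, ← sum_const]
    congr 1
    refine sum_congr rfl fun y hy ↦ ?_
    have hval (w : ZMod n) : χ w = χ.primitiveCharacter w.cast := by
      by_cases hw : IsUnit w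
      · exact apply_eq_primitiveCharacter_cast χ hw
      · rw [MulChar.map_nonunit _ hw, MulChar.map_nonunit]
        rw [← ZMod.natCast_val, ZMod.isUnit_iff_coprime]
        rw [← ZMod.natCast_zmod_val w, ZMod.isUnit_iff_coprime] at hw
        refine mt (fun h ↦ Nat.coprime_of_dvd fun p hpp hpw hpn ↦ ?_) hw
        have hpd : p ∈ χ.conductor.primeFactors :=
          hp ▸ Nat.mem_primeFactors.2 ⟨hpp, hpn, NeZero.ne n⟩
        exact Nat.not_coprime_of_dvd_of_dvd hpp.one_lt hpw (Nat.dvd_of_mem_primeFactors hpd) h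
    rw [hval, hval, (mem_filter.1 hy).2]
  · intro e he hne
    by_cases hd : χ.conductor ∣ e
    · rw [ArithmeticFunction.moebius_eq_zero_of_not_squarefree, Int.cast_zero, zero_mul]
      intro hsq
      refine hne (Nat.dvd_antisymm ?_ hd)
      rw [← Nat.prod_primeFactors_of_squarefree hsq]
      refine (prod_dvd_prod_of_subset _ _ _ ?_).trans (Nat.prod_primeFactors_dvd _)
      rw [← hp]
      exact Nat.primeFactors_mono (Nat.dvd_of_mem_divisors he) (NeZero.ne n)
    · rw [sum_fiber_cast_eq_zero χ (Nat.dvd_of_mem_divisors he) hd, mul_zero]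
  · intro h
    exact (h (Nat.mem_divisors.2 ⟨χ.conductor_dvd_level, NeZero.ne n⟩)).elim

/-- The sum of `χ (x - t₁ - ⋯ - t_k)` over all units `t₁, …, t_k` modulo `n`. -/
noncomputable def unitConv (χ : DirichletCharacter ℂ n) : ℕ → ZMod n → ℂ
  | 0, x => χ x
  | k + 1, x => ∑ t, (1 : DirichletCharacter ℂ n) t * unitConv χ k (x - t)

lemma unitConv_unit_mul (χ : DirichletCharacter ℂ n) (k : ℕ) (u : (ZMod n)ˣ) (x : ZMod n) :
    unitConv χ k (u * x) = χ u * unitConv χ k x := by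
  induction k generalizing x with
  | zero => simp [unitConv]
  | succ k ih =>
    simp only [unitConv]
    rw [mul_sum]
    refine (Fintype.sum_equiv (Units.mulLeft u) _ _ fun t ↦ ?_).symm
    rw [Units.mulLeft_apply, map_mul, MulChar.one_apply u.isUnit, one_mul, ← mul_sub, ih]
    ring

lemma unitConv_eq (χ : DirichletCharacter ℂ n)
    (hp : n.primeFactors = χ.conductor.primeFactors) (k : ℕ) (x : ZMod n) :
    unitConv χ k x =
      (ArithmeticFunction.moebius χ.conductor * (n / χ.conductor : ℕ)) ^ k * χ x := by
  induction k generalizing x with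
  | zero => simp [unitConv]
  | succ k ih =>
    simp only [unitConv, ih]
    rw [pow_succ, mul_assoc, ← sum_one_mul_apply_sub χ hp, mul_sum]
    exact sum_congr rfl fun t _ ↦ mul_left_comm _ _ _

lemma sum_pi_eq_sum_unitConv (χ : DirichletCharacter ℂ n) (k : ℕ) (H : ZMod n → ℂ) :
    ∑ a : Fin (k + 1) → ZMod n,
        χ (a 0) * (∏ i : Fin k, (1 : DirichletCharacter ℂ n) (a i.succ)) * H (∑ i, a i) =
      ∑ x, unitConv χ k x * H x := by
  induction k generalizing H with
  | zero =>
    refine Fintype.sum_equiv (Equiv.funUnique (Fin 1) (ZMod n)) _ _ fun a ↦ ?_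
    simp [unitConv]
  | succ k ih =>
    rw [← (Fin.snocEquiv fun _ : Fin (k + 2) ↦ ZMod n).sum_comp, Fintype.sum_prod_type]
    simp only [unitConv, sum_mul]
    rw [sum_comm (s := (univ : Finset (ZMod n))) (t := (univ : Finset (ZMod n)))]
    refine sum_congr rfl fun t _ ↦ ?_
    calc _ = (1 : DirichletCharacter ℂ n) t * ∑ b : Fin (k + 1) → ZMod n,
          χ (b 0) * (∏ i : Fin k, (1 : DirichletCharacter ℂ n) (b i.succ)) *
            H (∑ i, b i + t) := by
          rw [mul_sum]
          refine sum_congr rfl fun b _ ↦ ?_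
          have h0 : (Fin.snoc b t : Fin (k + 2) → ZMod n) 0 = b 0 :=
            Fin.snoc_castSucc (α := fun _ ↦ ZMod n) t b 0
          have hs (i : Fin k) : (Fin.snoc b t : Fin (k + 2) → ZMod n) i.castSucc.succ = b i.succ :=
            Fin.snoc_castSucc (α := fun _ ↦ ZMod n) t b i.succ
          simp only [Fin.snocEquiv, Equiv.coe_fn_mk]
          rw [Fin.prod_univ_castSucc, Fin.sum_univ_castSucc, h0, Fin.succ_last]
          simp only [hs, Fin.snoc_castSucc, Fin.snoc_last]
          ring
      _ = _ := by
          rw [ih fun x ↦ H (x + t), mul_sum]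
          refine Fintype.sum_equiv (Equiv.addRight t) _ _ fun x ↦ ?_
          simp [mul_assoc]

lemma unitConv_mul_of_coprime {m l : ℕ} [NeZero m] [NeZero l] [NeZero (m * l)]
    (h : m.Coprime l) (χ : DirichletCharacter ℂ m) (k : ℕ) (x : ZMod (m * l)) :
    unitConv (changeLevel (m.dvd_mul_right l) χ) k x =
      unitConv χ k x.cast * unitConv (1 : DirichletCharacter ℂ l) k x.cast := by
  have hprod (t : ZMod (m * l)) : ZMod.chineseRemainder h t = (t.cast, t.cast) :=
    Prod.ext (Prod.fst_zmod_cast t) (Prod.snd_zmod_cast t)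
  have hunit (t : ZMod (m * l)) :
      IsUnit t ↔ IsUnit (t.cast : ZMod m) ∧ IsUnit (t.cast : ZMod l) := by
    rw [← MulEquiv.isUnit_map (ZMod.chineseRemainder h), hprod, Prod.isUnit_iff]
  have hbase (ψ : DirichletCharacter ℂ m) (t : ZMod (m * l)) :
      changeLevel (m.dvd_mul_right l) ψ t =
        ψ t.cast * (1 : DirichletCharacter ℂ l) t.cast := by
    by_cases ht : IsUnit t
    · rw [MulChar.one_apply ((hunit t).1 ht).2, mul_one]
      exact changeLevel_eq_cast_of_dvd ψ (m.dvd_mul_right l) ht.unit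
    · rw [MulChar.map_nonunit _ ht]
      rw [hunit, not_and_or] at ht
      rcases ht with ht | ht <;> simp [MulChar.map_nonunit _ ht]
  induction k generalizing x with
  | zero => exact hbase χ x
  | succ k ih =>
    simp only [unitConv]
    rw [sum_mul_sum, ← Fintype.sum_prod_type']
    refine Fintype.sum_equiv (ZMod.chineseRemainder h).toEquiv _ _ fun t ↦ ?_
    have h1 := hbase 1 t
    rw [map_one] at h1
    rw [ih, h1, RingEquiv.toEquiv_eq_coe, RingEquiv.coe_toEquiv, hprod,
      ZMod.cast_sub (m.dvd_mul_right l), ZMod.cast_sub (l.dvd_mul_left m)]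
    ring

lemma sum_unitConv_mul (χ : DirichletCharacter ℂ n) (k : ℕ) (G : ZMod n → ℂ) :
    ∑ x, unitConv χ k x * ((1 : DirichletCharacter ℂ n) x * G x) =
      unitConv χ k 1 * ∑ x, χ x * G x := by
  rw [mul_sum]
  refine sum_congr rfl fun x _ ↦ ?_
  by_cases hx : IsUnit x
  · have := unitConv_unit_mul χ k hx.unit 1
    rw [mul_one, IsUnit.unit_spec] at this
    rw [this, MulChar.one_apply hx]
    ring
  · simp [MulChar.map_nonunit _ hx]

lemma sum_piFinset_Icc (k : ℕ) (F : (Fin k → ZMod n) → ℂ) :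
    ∑ a ∈ Fintype.piFinset fun _ : Fin k ↦ Icc 1 n, F (fun i ↦ (a i : ZMod n)) = ∑ a, F a := by
  refine sum_nbij (fun a i ↦ (a i : ZMod n)) (fun _ _ ↦ mem_univ _) ?_ ?_ fun _ _ ↦ rfl
  · intro a ha b hb hab
    ext i
    have ha' := mem_Icc.1 (Fintype.mem_piFinset.1 ha i)
    have hb' := mem_Icc.1 (Fintype.mem_piFinset.1 hb i)
    have h := (ZMod.natCast_eq_natCast_iff _ _ _).1 (congrFun hab i)
    have h' : a i - 1 ≡ b i - 1 [MOD n] := by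
      apply Nat.ModEq.add_right_cancel' 1
      rwa [Nat.sub_add_cancel ha'.1, Nat.sub_add_cancel hb'.1]
    have := h'.eq_of_lt_of_lt (by omega) (by omega)
    omega
  · intro z _
    refine ⟨fun i ↦ if z i = 0 then n else (z i).val, ?_, ?_⟩
    · refine mem_coe.2 (Fintype.mem_piFinset.2 fun i ↦ mem_Icc.2 ?_)
      have := (z i).val_lt
      have := Nat.pos_of_neZero n
      split_ifs with h
      · omega
      · have := (ZMod.val_ne_zero (z i)).2 h
        omega
    · ext i
      dsimp only
      split_ifs with h <;> simp [h]

lemma sum_filter_piFinset_Icc (χ : DirichletCharacter ℂ n) (k : ℕ) (G : ZMod n → ℂ) :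
    ∑ a ∈ (Fintype.piFinset fun _ : Fin (k + 1) ↦ Icc 1 n).filter
        (fun a ↦ Nat.gcd (∏ i, a i) n = 1 ∧ Nat.gcd (∑ i, a i) n = 1),
      G (∑ i, a i : ℕ) * χ (a 0 : ℕ) = unitConv χ k 1 * ∑ x, χ x * G x := by
  rw [← sum_unitConv_mul, ← sum_pi_eq_sum_unitConv, ← sum_piFinset_Icc, sum_filter]
  refine sum_congr rfl fun a _ ↦ ?_
  have hone (m : ℕ) : (1 : DirichletCharacter ℂ n) m = if m.gcd n = 1 then 1 else 0 := by
    split_ifs with h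
    · exact MulChar.one_apply ((ZMod.isUnit_iff_coprime m n).2 h)
    · exact MulChar.map_nonunit _ ((ZMod.isUnit_iff_coprime m n).not.2 h)
  have hχ : χ (a 0 : ℕ) * ∏ i : Fin k, (1 : DirichletCharacter ℂ n) (a i.succ : ℕ) =
      χ (a 0 : ℕ) * (1 : DirichletCharacter ℂ n) (∏ i, a i : ℕ) := by
    rw [Nat.cast_prod, map_prod, Fin.prod_univ_succ, ← mul_assoc, ← MulChar.mul_apply, mul_one]
  rw [hχ, ← Nat.cast_sum, hone, hone]
  split_ifs <;> simp_all [mul_comm]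

lemma tothPhi_eq (k : ℕ) :
    (tothPhi (k + 1) n : ℂ) = n.totient * unitConv (1 : DirichletCharacter ℂ n) k 1 := by
  have h := sum_filter_piFinset_Icc (1 : DirichletCharacter ℂ n) k 1
  simp only [Pi.one_apply, mul_one, one_mul] at h
  rw [MulChar.sum_one_eq_card_units, ZMod.card_units_eq_totient] at h
  rw [mul_comm, ← h, tothPhi, card_eq_sum_ones, Nat.cast_sum]
  refine sum_congr rfl fun a ha ↦ ?_
  rw [MulChar.one_apply, Nat.cast_one]
  rw [ZMod.isUnit_iff_coprime]
  exact Nat.Coprime.coprime_dvd_left (dvd_prod_of_mem a (mem_univ 0)) (mem_filter.1 ha).2.1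

lemma sum_gcd_eq (s N : ℕ) (r : ℤ) :
    ∑ b ∈ Fintype.piFinset (fun _ : Fin s ↦ Icc 1 n),
        Int.gcd ((N : ℤ) - r) ((Nat.gcd (univ.gcd b) n : ℕ) : ℤ) =
      ∑ e ∈ n.divisors, if (N : ZMod e) = r then e.totient * (n / e) ^ s else 0 := by
  have hgcd (b : Fin s → ℕ) : Int.gcd ((N : ℤ) - r) ((Nat.gcd (univ.gcd b) n : ℕ) : ℤ) =
      ∑ e ∈ n.divisors, if (N : ZMod e) = r then
        (if ∀ i, e ∣ b i then e.totient else 0) else 0 := by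
    rw [← Nat.sum_totient (Int.gcd _ _)]
    simp only [← ite_and]
    rw [← sum_filter]
    refine sum_congr ?_ fun _ _ ↦ rfl
    ext e
    have hn := NeZero.ne n
    have h1 : Int.gcd ((N : ℤ) - r) ((Nat.gcd (univ.gcd b) n : ℕ) : ℤ) ≠ 0 := by
      simp [Int.gcd_eq_zero_iff, Nat.gcd_eq_zero_iff, hn]
    have h2 : (N : ZMod e) = r ↔ (e : ℤ) ∣ N - r := by
      rw [← Int.cast_natCast, eq_comm, ZMod.intCast_eq_intCast_iff_dvd_sub]
    have h3 : e ∣ univ.gcd b ↔ ∀ i, e ∣ b i := by simp [Finset.dvd_gcd_iff]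
    rw [mem_filter, Nat.mem_divisors, Nat.mem_divisors, Int.dvd_gcd_iff,
      Int.natCast_dvd_natCast, Nat.dvd_gcd_iff, h2, h3]
    tauto
  have hcount (e : ℕ) :
      #{b ∈ Fintype.piFinset (fun _ : Fin s ↦ Icc 1 n) | ∀ i, e ∣ b i} = (n / e) ^ s := by
    have : {b ∈ Fintype.piFinset (fun _ : Fin s ↦ Icc 1 n) | ∀ i, e ∣ b i} =
        Fintype.piFinset fun _ : Fin s ↦ {b ∈ Ioc 0 n | e ∣ b} := by
      ext b
      simp only [mem_filter, Fintype.mem_piFinset, mem_Icc, mem_Ioc, Nat.one_le_iff_ne_zero,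
        Nat.pos_iff_ne_zero, forall_and]
    rw [this, Fintype.card_piFinset_const, Nat.Ioc_filter_dvd_card_eq_div]
  simp_rw [hgcd]
  rw [sum_comm]
  refine sum_congr rfl fun e _ ↦ ?_
  split_ifs with h
  · rw [← sum_filter, sum_const, hcount, smul_eq_mul, mul_comm]
  · exact sum_const_zero

lemma sum_apply_mul_sum_divisors (χ : DirichletCharacter ℂ n) {r : ℤ} (hr : IsCoprime r n)
    (s : ℕ) :
    ∑ x : ZMod n, χ x * ∑ e ∈ n.divisors,
        (if (x.cast : ZMod e) = r then ((e.totient * (n / e) ^ s : ℕ) : ℂ) else 0) =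
      n.totient * χ.primitiveCharacter r * ∑ e ∈ (n / χ.conductor).divisors, (e : ℂ) ^ s := by
  have hfib (e : ℕ) (he : e ∈ n.divisors) :
      ∑ x : ZMod n, χ x * (if (x.cast : ZMod e) = r then
        ((e.totient * (n / e) ^ s : ℕ) : ℂ) else 0) =
      if χ.conductor ∣ e then n.totient * χ.primitiveCharacter r * ((n / e : ℕ) : ℂ) ^ s
        else 0 := by
    have he' := Nat.dvd_of_mem_divisors he
    have : ∑ x : ZMod n, χ x * (if (x.cast : ZMod e) = r then
        ((e.totient * (n / e) ^ s : ℕ) : ℂ) else 0) =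
        (e.totient * ∑ y : ZMod n with (y.cast : ZMod e) = r, χ y) * ((n / e : ℕ) : ℂ) ^ s := by
      rw [sum_filter, mul_sum, sum_mul]
      refine sum_congr rfl fun x _ ↦ ?_
      split_ifs <;> push_cast <;> ring
    rw [this]
    split_ifs with hd
    · rw [totient_mul_sum_fiber χ he' hd hr]
    · rw [sum_fiber_cast_eq_zero χ he' hd, mul_zero, zero_mul]
  simp_rw [mul_sum]
  rw [sum_comm, sum_congr rfl hfib, ← sum_filter]
  obtain ⟨c, hc⟩ := χ.conductor_dvd_level
  have hd0 : χ.conductor ≠ 0 := χ.conductor_ne_zero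
  have hn0 := NeZero.ne n
  have hc' : n / χ.conductor = c :=
    Nat.div_eq_of_eq_mul_right (Nat.pos_of_ne_zero hd0) hc
  have hc0 : c ≠ 0 := by
    rintro rfl
    exact hn0 (by simpa using hc)
  rw [hc']
  refine sum_nbij' (fun e ↦ n / e) (fun e ↦ n / e) ?_ ?_ ?_ ?_ fun _ _ ↦ rfl
  · intro e he
    obtain ⟨he, g, rfl⟩ := mem_filter.1 he
    obtain ⟨f, hf⟩ := Nat.dvd_of_mem_divisors he
    rw [Nat.div_eq_of_eq_mul_right (Nat.pos_of_mem_divisors he) hf, Nat.mem_divisors]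
    refine ⟨⟨g, ?_⟩, hc0⟩
    apply Nat.eq_of_mul_eq_mul_left (Nat.pos_of_ne_zero hd0)
    exact hc.symm.trans (hf.trans (by ring))
  · intro e he
    obtain ⟨g, hg⟩ := Nat.dvd_of_mem_divisors he
    have hn : n = e * (χ.conductor * g) := by
      rw [mul_left_comm, ← hg]
      exact hc
    rw [Nat.div_eq_of_eq_mul_right (Nat.pos_of_mem_divisors he) hn, mem_filter, Nat.mem_divisors]
    exact ⟨⟨⟨e, hn.trans (mul_comm _ _)⟩, hn0⟩, dvd_mul_right _ _⟩
  · intro e he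
    exact Nat.div_div_self (Nat.dvd_of_mem_divisors (mem_filter.1 he).1) hn0
  · intro e he
    refine Nat.div_div_self ?_ hn0
    exact (Nat.dvd_of_mem_divisors he).trans ⟨_, hc.trans (mul_comm _ _)⟩

end DirichletCharacter

lemma Nat.totient_pow_mul_of_dvd {m N : ℕ} (h : m ∣ N) (j : ℕ) :
    (m ^ j * N).totient = m ^ j * N.totient := by
  induction j with
  | zero => simp
  | succ j ih =>
    rcases m.eq_zero_or_pos with rfl | hm
    · simp
    have hd : m ∣ m ^ j * N := h.mul_left _
    have hg := Nat.totient_gcd_mul_totient_mul m (m ^ j * N)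
    rw [Nat.gcd_eq_left hd, mul_assoc] at hg
    have := Nat.eq_of_mul_eq_mul_left (Nat.totient_pos.2 hm) hg
    rw [pow_succ', mul_assoc, this, ih]
    ring

/-- Rational specialization of the paper's main corollary: for a Dirichlet
character `χ` modulo `n` with conductor `d` induced by the primitive character
`ψ`, an integer `r` coprime to `n`, and `n₀ ∣ n` having the same prime factors
as `d` with `gcd(n₀, n/n₀) = 1`,
`∑ gcd(a₁+⋯+a_k−r, b₁, …, b_s, n) χ(a₁)
  = μ(d)^{k−1} ψ(r) φ(n₀^k/d^{k−1}) φ_k(n/n₀) σ_s(n/d)`,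
the sum being over `1 ≤ aᵢ ≤ n` with `gcd(a₁⋯a_k, n) = 1` and
`gcd(a₁+⋯+a_k, n) = 1`, and `1 ≤ bⱼ ≤ n`. -/
theorem menon_toth_rational (k n : ℕ) (hk : 0 < k) (hn : 0 < n) (s : ℕ)
    (χ : DirichletCharacter ℂ n) (r : ℤ) (hr : Int.gcd r n = 1)
    (n₀ : ℕ) (h₀ : n₀ ∣ n) (hsame : n₀.primeFactors = χ.conductor.primeFactors)
    (hcop : Nat.Coprime n₀ (n / n₀)) :
    (∑ a ∈ (Fintype.piFinset fun _ : Fin k => Finset.Icc 1 n).filter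
        (fun a => Nat.gcd (∏ i, a i) n = 1 ∧ Nat.gcd (∑ i, a i) n = 1),
      ∑ b ∈ Fintype.piFinset (fun _ : Fin s => Finset.Icc 1 n),
        (Int.gcd ((∑ i, a i : ℕ) - r) ((Nat.gcd (Finset.univ.gcd b) n : ℕ) : ℤ) : ℂ) *
          χ ((a ⟨0, hk⟩ : ℕ) : ZMod n)) =
      (ArithmeticFunction.moebius χ.conductor : ℂ) ^ (k - 1) *
        χ.primitiveCharacter ((r : ZMod χ.conductor)) *
        (Nat.totient (n₀ ^ k / χ.conductor ^ (k - 1)) : ℂ) *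
        (tothPhi k (n / n₀) : ℂ) *
        (∑ e ∈ (n / χ.conductor).divisors, (e : ℂ) ^ s) := by
  obtain ⟨k, rfl⟩ := Nat.exists_eq_add_one.2 hk
  have : NeZero n := ⟨hn.ne'⟩
  have hmain := χ.sum_filter_piFinset_Icc k fun x ↦ ∑ e ∈ n.divisors,
    if (x.cast : ZMod e) = r then ((e.totient * (n / e) ^ s : ℕ) : ℂ) else 0
  rw [DirichletCharacter.sum_apply_mul_sum_divisors χ (Int.isCoprime_iff_gcd_eq_one.2 hr)] at hmain
  refine Eq.trans (Finset.sum_congr rfl fun a _ ↦ ?_) (hmain.trans ?_)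
  · rw [← Finset.sum_mul, ← Nat.cast_sum, DirichletCharacter.sum_gcd_eq, Nat.cast_sum]
    congr 1
    refine Finset.sum_congr rfl fun e he ↦ ?_
    rw [ZMod.cast_natCast (Nat.dvd_of_mem_divisors he), Nat.cast_ite, Nat.cast_zero]
  obtain ⟨l, rfl⟩ := h₀
  have hm0 : n₀ ≠ 0 := by rintro rfl; simp at hn
  have hl0 : l ≠ 0 := by rintro rfl; simp at hn
  have : NeZero n₀ := ⟨hm0⟩
  have : NeZero l := ⟨hl0⟩
  rw [Nat.mul_div_cancel_left _ (Nat.pos_of_ne_zero hm0)] at hcop ⊢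
  have hd0 : χ.conductor ≠ 0 := χ.conductor_ne_zero
  have hdn : χ.conductor ∣ n₀ := by
    refine Nat.Coprime.dvd_of_dvd_mul_right ?_ χ.conductor_dvd_level
    refine Nat.coprime_of_dvd fun p hp hpd hpl ↦ ?_
    have hpn : p ∈ n₀.primeFactors := hsame ▸ Nat.mem_primeFactors.2 ⟨hp, hpd, hd0⟩
    exact Nat.not_coprime_of_dvd_of_dvd hp.one_lt (Nat.dvd_of_mem_primeFactors hpn) hpl hcop
  obtain ⟨h', χ', hχ'⟩ := (χ.factorsThrough_conductor.mono χ hdn (n₀.dvd_mul_right l))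
  have hcond : χ'.conductor = χ.conductor := by
    rw [hχ', DirichletCharacter.conductor_changeLevel]
  have hconv : χ.unitConv k 1 =
      (ArithmeticFunction.moebius χ.conductor * (n₀ / χ.conductor : ℕ)) ^ k *
        DirichletCharacter.unitConv (1 : DirichletCharacter ℂ l) k 1 := by
    have h1 := DirichletCharacter.unitConv_mul_of_coprime hcop χ' k 1
    rw [← hχ', ZMod.cast_one h', ZMod.cast_one (l.dvd_mul_left n₀),
      DirichletCharacter.unitConv_eq χ' (by rw [hcond, hsame]), map_one, mul_one, hcond] at h1
    exact h1
  have htot : (n₀ ^ (k + 1) / χ.conductor ^ k).totient =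
      (n₀ / χ.conductor) ^ k * n₀.totient := by
    rw [pow_succ, Nat.mul_div_right_comm (pow_dvd_pow_of_dvd hdn k), ← Nat.div_pow hdn,
      Nat.totient_pow_mul_of_dvd (Nat.div_dvd_of_dvd hdn)]
  rw [hconv, Nat.add_sub_cancel, htot, DirichletCharacter.tothPhi_eq, Nat.totient_mul hcop]
  push_cast
  ring
end
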